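/- Assume ω is symmetric, and let e be a nilpotent endomorphism of V that is skew-adjoint with respect to ω. Then for every even integer s ≥ 2, the integer rank(e^{s−1}) + rank(e^{s+1}) is even. Equivalently, for every even s ≥ 2 the number of Jordan blocks of e of size s, which equals rank(e^{s−1}) − 2·rank(e^s) + rank(e^{s+1}), is even. -/

import Mathlib

open Module Submodule

lemma even_aux (V : Type*) [AddCommGroup V] [Module ℂ V] [FiniteDimensional ℂ V]
    (B : V →ₗ[ℂ] V →ₗ[ℂ] ℂ) (hnd : ∀ v, (∀ w, B v w = 0) → v = 0)
    (hsk : ∀ v w, B v w = - B w v) : Even (finrank ℂ V) := by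
  by_contra hodd
  rw [Nat.not_even_iff_odd] at hodd
  let b := Module.finBasis ℂ V
  have hdet : (LinearMap.toMatrix₂ b b B).det ≠ 0 := by
    rw [← LinearMap.separatingLeft_iff_det_ne_zero b]
    exact hnd
  have ht : (LinearMap.toMatrix₂ b b B) = - (LinearMap.toMatrix₂ b b B).transpose := by
    ext i j
    simp only [Matrix.neg_apply, Matrix.transpose_apply, LinearMap.toMatrix₂_apply]
    exact hsk _ _
  have h2 := congrArg Matrix.det ht
  rw [Matrix.det_neg, Matrix.det_transpose, Fintype.card_fin, hodd.neg_one_pow] at h2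
  apply hdet
  linear_combination h2 / 2

lemma even_rank_aux (V : Type*) [AddCommGroup V] [Module ℂ V] [FiniteDimensional ℂ V]
    (ω : V →ₗ[ℂ] V →ₗ[ℂ] ℂ)
    (hnd : ∀ v, (∀ w, ω v w = 0) → v = 0)
    (hsym : ∀ v w, ω v w = ω w v)
    (f : Module.End ℂ V)
    (hskew : ∀ v w, ω (f v) w = - ω v (f w)) :
    Even (finrank ℂ (LinearMap.range f)) := by
  obtain ⟨W, hW⟩ := Submodule.exists_isCompl (LinearMap.ker f)
  have h1 := Submodule.finrank_add_eq_of_isCompl hW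
  have h2 := LinearMap.finrank_range_add_finrank_ker f
  have h3 : finrank ℂ (LinearMap.range f) = finrank ℂ W := by omega
  rw [h3]
  refine even_aux W ((ω.comp f).compl₁₂ W.subtype W.subtype) ?_ ?_
  · intro v hv
    have hk : f v = 0 := by
      apply hnd
      intro w
      have hw : w ∈ LinearMap.ker f ⊔ W := by rw [hW.sup_eq_top]; trivial
      obtain ⟨x, hx, y, hy, rfl⟩ := Submodule.mem_sup.1 hw
      have hy' := hv ⟨y, hy⟩
      simp only [LinearMap.compl₁₂_apply, LinearMap.comp_apply, Submodule.subtype_apply] at hy'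
      rw [map_add, hy', hskew, LinearMap.mem_ker.1 hx]
      simp
    have : (v : V) ∈ LinearMap.ker f ⊓ W := ⟨hk, v.2⟩
    rw [hW.inf_eq_bot] at this
    exact Subtype.ext ((Submodule.mem_bot ℂ).1 this)
  · intro v w
    simp only [LinearMap.compl₁₂_apply, LinearMap.comp_apply, Submodule.subtype_apply]
    rw [hskew, hsym]

/-- Parity constraint on Jordan types of nilpotent elements of an
orthogonal Lie algebra: if `ω` is nondegenerate symmetric and `e` is a nilpotent
endomorphism skew-adjoint with respect to `ω`, then for every even `s ≥ 2` the integer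
`rank(e^{s−1}) + rank(e^{s+1})` is even. -/
theorem stmt_17 (V : Type*) [AddCommGroup V] [Module ℂ V] [FiniteDimensional ℂ V]
    (ω : V →ₗ[ℂ] V →ₗ[ℂ] ℂ)
    (hnd : ∀ v, (∀ w, ω v w = 0) → v = 0)
    (hsym : ∀ v w, ω v w = ω w v)
    (e : Module.End ℂ V) (hnil : IsNilpotent e)
    (hskew : ∀ v w, ω (e v) w = - ω v (e w)) :
    ∀ s : ℕ, 2 ≤ s → Even s →
      Even (finrank ℂ (LinearMap.range (e ^ (s - 1))) +
        finrank ℂ (LinearMap.range (e ^ (s + 1)))) := by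
  intro s hs hev
  have key : ∀ (k : ℕ) (v w : V), ω ((e ^ k) v) w = (-1) ^ k * ω v ((e ^ k) w) := by
    intro k
    induction k with
    | zero => intro v w; simp
    | succ k ih =>
      intro v w
      rw [pow_succ, Module.End.mul_apply, ih, hskew, ← Module.End.mul_apply e, ← pow_succ',
        ← pow_succ e]
      ring
  have odd : ∀ k : ℕ, Odd k → Even (finrank ℂ (LinearMap.range (e ^ k))) := by
    intro k hk
    refine even_rank_aux V ω hnd hsym (e ^ k) ?_
    intro v w
    rw [key, hk.neg_one_pow]
    ring
  exact (odd _ (Nat.Even.sub_odd (by omega) hev odd_one)).add (odd _ hev.add_one)
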